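/- For integers 0 ≤ k ≤ n, the generating polynomial, by size, of integer partitions with at most k parts and each part at most n−k equals the Gaussian binomial coefficient [n, k]_q. Concretely, ∑_λ q^{λ(0)+λ(1)+⋯+λ(k−1)} = [n, k]_q in ℤ[q], where the sum ranges over all weakly decreasing functions λ : {0, 1, …, k−1} → {0, 1, …, n−k}. -/

import Mathlib

/-- The Gaussian (q-)binomial coefficient `[n, k]_q` as a polynomial in `ℤ[q]`,
defined by `[n, 0] = 1`, `[0, k+1] = 0` and
`[n+1, k+1] = [n, k] + q^(k+1) * [n, k+1]` (so `[n, k] = 0` for `k > n`). -/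
noncomputable def gaussBinom : ℕ → ℕ → Polynomial ℤ
  | _, 0 => 1
  | 0, _ + 1 => 0
  | n + 1, k + 1 => gaussBinom n k + Polynomial.X ^ (k + 1) * gaussBinom n (k + 1)

theorem gaussBinom_zero_right (n : ℕ) : gaussBinom n 0 = 1 := by
  cases n <;> rfl

theorem gaussBinom_succ_succ (n k : ℕ) : gaussBinom (n + 1) (k + 1) =
    gaussBinom n k + Polynomial.X ^ (k + 1) * gaussBinom n (k + 1) := rfl

theorem gaussBinom_eq_zero_of_lt {n k : ℕ} (h : n < k) : gaussBinom n k = 0 := by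
  induction n generalizing k with
  | zero =>
    obtain ⟨k, rfl⟩ := Nat.exists_eq_succ_of_ne_zero h.ne'
    rfl
  | succ n ih =>
    obtain ⟨k, rfl⟩ := Nat.exists_eq_succ_of_ne_zero (Nat.ne_zero_of_lt h)
    rw [Nat.succ_eq_add_one, gaussBinom_succ_succ, ih (by omega), ih (by omega)]
    simp

theorem gaussBinom_self (n : ℕ) : gaussBinom n n = 1 := by
  induction n with
  | zero => rfl
  | succ n ih =>
    rw [gaussBinom_succ_succ, ih, gaussBinom_eq_zero_of_lt n.lt_succ_self]
    simp

/-- Partitions with at most `k` parts, each at most `m`. -/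
def boxPartitions (k m : ℕ) : Finset (Fin k → Fin (m + 1)) :=
  Finset.univ.filter fun lam => ∀ i j : Fin k, i ≤ j → lam j ≤ lam i

theorem mem_boxPartitions {k m : ℕ} {lam : Fin k → Fin (m + 1)} :
    lam ∈ boxPartitions k m ↔ ∀ i j : Fin k, i ≤ j → lam j ≤ lam i := by
  simp [boxPartitions]

/-- The generating polynomial, by size, of the partitions in a `k × m` box. -/
noncomputable def boxGenPoly (k m : ℕ) : Polynomial ℤ :=
  ∑ lam ∈ boxPartitions k m, Polynomial.X ^ (∑ i : Fin k, (lam i : ℕ))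

theorem boxGenPoly_zero_left (m : ℕ) : boxGenPoly 0 m = 1 := by
  simp [boxGenPoly, boxPartitions]

theorem boxGenPoly_zero_right (k : ℕ) : boxGenPoly k 0 = 1 := by
  simp [boxGenPoly, boxPartitions]

/-- Removing a smallest part equal to zero. -/
theorem sum_boxPartitions_last_eq_zero (k m : ℕ) :
    ∑ lam ∈ boxPartitions (k + 1) m with lam (Fin.last k) = 0,
      (Polynomial.X : Polynomial ℤ) ^ (∑ i, (lam i : ℕ)) = boxGenPoly k m := by
  symm
  refine Finset.sum_nbij' (fun mu => Fin.snoc (α := fun _ => Fin (m + 1)) mu 0)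
    (fun lam i => lam i.castSucc) ?_ ?_ ?_ ?_ ?_
  · intro mu hmu
    rw [mem_boxPartitions] at hmu
    rw [Finset.mem_filter, mem_boxPartitions]
    refine ⟨fun i j => ?_, by simp⟩
    induction j using Fin.lastCases with
    | last => simp
    | cast j =>
      induction i using Fin.lastCases with
      | last => intro h; exact absurd h (not_le.2 j.castSucc_lt_last)
      | cast i => simpa using hmu i j
  · intro lam hlam
    rw [Finset.mem_filter, mem_boxPartitions] at hlam
    rw [mem_boxPartitions]
    exact fun i j h => hlam.1 _ _ (Fin.castSucc_le_castSucc_iff.2 h)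
  · intro mu _
    simp
  · intro lam hlam
    funext i
    induction i using Fin.lastCases with
    | last => simp [(Finset.mem_filter.1 hlam).2]
    | cast i => simp
  · intro mu _
    simp [Fin.sum_univ_castSucc]

/-- Subtracting one from every part when the smallest part is positive. -/
theorem sum_boxPartitions_last_ne_zero (k m : ℕ) :
    ∑ lam ∈ boxPartitions (k + 1) (m + 1) with ¬ lam (Fin.last k) = 0,
      (Polynomial.X : Polynomial ℤ) ^ (∑ i, (lam i : ℕ)) =
    Polynomial.X ^ (k + 1) * boxGenPoly (k + 1) m := by
  symm
  rw [boxGenPoly, Finset.mul_sum]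
  refine Finset.sum_nbij (fun mu i => (mu i).succ) ?_ ?_ ?_ ?_
  · intro mu hmu
    rw [mem_boxPartitions] at hmu
    rw [Finset.mem_filter, mem_boxPartitions]
    exact ⟨fun i j h => Fin.succ_le_succ_iff.2 (hmu i j h), Fin.succ_ne_zero _⟩
  · intro mu _ nu _ h
    funext i
    exact Fin.succ_injective _ (congrFun h i)
  · intro lam hlam
    rw [Finset.mem_coe, Finset.mem_filter, mem_boxPartitions] at hlam
    have hpos (i) : lam i ≠ 0 := fun h =>
      hlam.2 (Fin.le_zero_iff.1 (h ▸ hlam.1 i _ (Fin.le_last i)))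
    refine ⟨fun i => (lam i).pred (hpos i), ?_, by simp⟩
    rw [Finset.mem_coe, mem_boxPartitions]
    exact fun i j h => Fin.pred_le_pred_iff.2 (hlam.1 i j h)
  · intro mu _
    simp [Finset.sum_add_distrib, pow_add, mul_comm]

theorem boxGenPoly_succ_succ (k m : ℕ) : boxGenPoly (k + 1) (m + 1) =
    boxGenPoly k (m + 1) + Polynomial.X ^ (k + 1) * boxGenPoly (k + 1) m := by
  rw [← sum_boxPartitions_last_eq_zero k, ← sum_boxPartitions_last_ne_zero,
    Finset.sum_filter_add_sum_filter_not, boxGenPoly]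

theorem boxGenPoly_eq_gaussBinom (k m : ℕ) : boxGenPoly k m = gaussBinom (m + k) k := by
  induction k generalizing m with
  | zero => rw [boxGenPoly_zero_left, gaussBinom_zero_right]
  | succ k ihk =>
    induction m with
    | zero => rw [boxGenPoly_zero_right, Nat.zero_add, gaussBinom_self]
    | succ m ihm =>
      rw [boxGenPoly_succ_succ, ihk, ihm, Nat.add_right_comm m 1 (k + 1),
        gaussBinom_succ_succ (m + (k + 1)), Nat.add_assoc m 1 k, Nat.add_comm 1 k]

/-- the generating polynomial, by size, of partitions with at most `k`
parts and each part at most `n - k` (encoded as weakly decreasing functions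
`Fin k → Fin (n - k + 1)`) equals `[n, k]_q`. -/
theorem stmt8 (n k : ℕ) (hk : k ≤ n) :
    ∑ lam ∈ Finset.univ.filter
        (fun lam : Fin k → Fin (n - k + 1) => ∀ i j : Fin k, i ≤ j → lam j ≤ lam i),
      (Polynomial.X : Polynomial ℤ) ^ (∑ i : Fin k, (lam i : ℕ))
    = gaussBinom n k := by
  have h := boxGenPoly_eq_gaussBinom k (n - k)
  rwa [Nat.sub_add_cancel hk] at h
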